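/- If f : ℝⁿ → ℝ is Lipschitz continuous, then the gradient of its Gaussian smoothing fᵘ satisfies ∇fᵘ(x) = E_{u ~ N(0,I)}[((f(x + μu) - f(x))/μ) u] for every x ∈ ℝⁿ. -/

import Mathlib

open MeasureTheory

/-- The standard Gaussian measure `N(0, I)` on `ℝⁿ`. -/
noncomputable def stdGaussian (n : ℕ) : Measure (EuclideanSpace ℝ (Fin n)) :=
  (Measure.pi fun _ : Fin n => ProbabilityTheory.gaussianReal 0 1).map
    (EuclideanSpace.equiv (Fin n) ℝ).symm

/-- Gaussian smoothing `fᵘ(x) = E_{u ~ N(0,I)}[f(x + μ u)]`. -/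
noncomputable def gaussianSmoothing {n : ℕ} (f : EuclideanSpace ℝ (Fin n) → ℝ) (μ : ℝ) :
    EuclideanSpace ℝ (Fin n) → ℝ :=
  fun x => ∫ u, f (x + μ • u) ∂(stdGaussian n)

section GaussianIntegrals

open ProbabilityTheory hiding stdGaussian
open Set Topology
open scoped ENNReal

lemma gaussianReal_eq_withDensity (m : ℝ) :
    gaussianReal m 1 =
      (gaussianReal 0 1).withDensity fun x => ENNReal.ofReal (Real.exp (m * x - m ^ 2 / 2)) := by
  rw [gaussianReal_of_var_ne_zero _ one_ne_zero, gaussianReal_of_var_ne_zero _ one_ne_zero,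
    ← withDensity_mul _ (measurable_gaussianPDF _ _) (by fun_prop)]
  congr 1
  ext x
  simp only [gaussianPDF, gaussianPDFReal, Pi.mul_apply]
  rw [← ENNReal.ofReal_mul (by positivity), mul_assoc (Real.sqrt _)⁻¹, ← Real.exp_add]
  congr 3
  simp
  ring

lemma pi_withDensity_prod {ι : Type*} [Fintype ι] {X : ι → Type*} [∀ i, MeasurableSpace (X i)]
    (ν : ∀ i, Measure (X i)) [∀ i, IsProbabilityMeasure (ν i)] {g : ∀ i, X i → ℝ≥0∞}
    (hg : ∀ i, Measurable (g i)) [∀ i, SigmaFinite ((ν i).withDensity (g i))] :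
    Measure.pi (fun i => (ν i).withDensity (g i)) =
      (Measure.pi ν).withDensity fun x => ∏ i, g i (x i) := by
  classical
  refine Measure.pi_eq fun s hs => ?_
  have hmeas (i : ι) : Measurable ((s i).indicator (g i)) := (hg i).indicator (hs i)
  have hind : iIndepFun (fun i (x : ∀ i, X i) => (s i).indicator (g i) (x i)) (Measure.pi ν) :=
    iIndepFun_pi (X := fun i => (s i).indicator (g i)) fun i => (hmeas i).aemeasurable
  rw [withDensity_apply _ (MeasurableSet.univ_pi hs),
    ← lintegral_indicator (MeasurableSet.univ_pi hs)]
  have hprod (x : ∀ i, X i) : (univ.pi s).indicator (fun x => ∏ i, g i (x i)) x =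
      ∏ i, (s i).indicator (g i) (x i) := by
    by_cases hx : x ∈ univ.pi s
    · rw [indicator_of_mem hx]
      exact Finset.prod_congr rfl fun i _ => (indicator_of_mem (hx i (mem_univ i)) _).symm
    · rw [indicator_of_notMem hx]
      simp only [mem_univ_pi, not_forall] at hx
      obtain ⟨i, hi⟩ := hx
      exact (Finset.prod_eq_zero (Finset.mem_univ i) (indicator_of_notMem hi _)).symm
  simp_rw [hprod]
  rw [lintegral_prod_eq_prod_lintegral_of_indepFun Finset.univ _ hind
    fun i => (hmeas i).comp (measurable_pi_apply i)]
  refine Finset.prod_congr rfl fun i _ => ?_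
  rw [withDensity_apply _ (hs i), ← lintegral_indicator (hs i),
    ← (measurePreserving_eval ν i).lintegral_comp (hmeas i)]

lemma stdGaussian_eq (n : ℕ) :
    stdGaussian n = ProbabilityTheory.stdGaussian (EuclideanSpace ℝ (Fin n)) :=
  map_pi_eq_stdGaussian

lemma integral_stdGaussian {n : ℕ} {E : Type*} [NormedAddCommGroup E] [NormedSpace ℝ E]
    (F : EuclideanSpace ℝ (Fin n) → E) :
    ∫ v, F v ∂(stdGaussian n) =
      ∫ w, F (WithLp.toLp 2 w) ∂(Measure.pi fun _ : Fin n => gaussianReal 0 1) :=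
  integral_map_equiv (MeasurableEquiv.toLp 2 (Fin n → ℝ)) F

lemma map_add_pi_gaussianReal {n : ℕ} (h : Fin n → ℝ) :
    (Measure.pi fun _ : Fin n => gaussianReal 0 1).map (fun w => w + h) =
      (Measure.pi fun _ : Fin n => gaussianReal 0 1).withDensity fun w =>
        ∏ i, ENNReal.ofReal (Real.exp (h i * w i - h i ^ 2 / 2)) := by
  have hsf (i : Fin n) : SigmaFinite ((gaussianReal 0 1).withDensity
      fun x => ENNReal.ofReal (Real.exp (h i * x - h i ^ 2 / 2))) := by
    rw [← gaussianReal_eq_withDensity]; infer_instance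
  rw [← pi_withDensity_prod (fun _ : Fin n => gaussianReal 0 1)
    (g := fun i x => ENNReal.ofReal (Real.exp (h i * x - h i ^ 2 / 2))) fun i => by fun_prop]
  simp_rw [← gaussianReal_eq_withDensity]
  have := Measure.pi_map_pi (μ := fun _ : Fin n => gaussianReal 0 1)
    (f := fun i x => x + h i) (fun i => by fun_prop)
  simp only [gaussianReal_map_add_const, zero_add] at this
  exact this

/-- The Cameron–Martin formula for the standard Gaussian measure. -/
lemma integral_stdGaussian_add {n : ℕ} {E : Type*} [NormedAddCommGroup E] [NormedSpace ℝ E]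
    (F : EuclideanSpace ℝ (Fin n) → E) (h : EuclideanSpace ℝ (Fin n)) :
    ∫ v, F (v + h) ∂(stdGaussian n) =
      ∫ v, Real.exp (inner ℝ h v - ‖h‖ ^ 2 / 2) • F v ∂(stdGaussian n) := by
  rw [integral_stdGaussian, integral_stdGaussian]
  have h1 := integral_map_equiv (μ := Measure.pi fun _ : Fin n => gaussianReal 0 1)
    (MeasurableEquiv.addRight (h : Fin n → ℝ)) (fun w => F (WithLp.toLp 2 w))
  have h2 : ⇑(MeasurableEquiv.addRight (h : Fin n → ℝ)) = fun w => w + (h : Fin n → ℝ) := rfl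
  rw [h2, map_add_pi_gaussianReal, integral_withDensity_eq_integral_toReal_smul
    (by fun_prop) (by simp [ENNReal.prod_lt_top])] at h1
  refine h1.symm.trans (integral_congr_ae (.of_forall fun w => ?_))
  simp only [ENNReal.toReal_prod, ENNReal.toReal_ofReal (Real.exp_pos _).le, ← Real.exp_sum]
  congr 2
  rw [EuclideanSpace.real_norm_sq_eq, Finset.sum_sub_distrib, Finset.sum_div,
    PiLp.inner_apply]
  simp [mul_comm]

lemma integrable_exp_mul_norm_stdGaussian (n : ℕ) (c : ℝ) :
    Integrable (fun v => Real.exp (c * ‖v‖)) (stdGaussian n) := by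
  rw [stdGaussian_eq]
  obtain ⟨C, hC, hint⟩ := IsGaussian.exists_integrable_exp_sq
    (ProbabilityTheory.stdGaussian (EuclideanSpace ℝ (Fin n)))
  refine (hint.const_mul (Real.exp (c ^ 2 / (4 * C)))).mono' (by fun_prop) (.of_forall fun v => ?_)
  rw [Real.norm_of_nonneg (Real.exp_pos _).le, ← Real.exp_add]
  gcongr
  have : 0 ≤ (2 * C * ‖v‖ - c) ^ 2 / (4 * C) := by positivity
  have h2 : (2 * C * ‖v‖ - c) ^ 2 / (4 * C) =
    c ^ 2 / (4 * C) + C * ‖v‖ ^ 2 - c * ‖v‖ := by field_simp; ring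
  linarith

/-- Differentiation of a Gaussian integral with respect to a translation of the integrand. -/
lemma hasGradientAt_integral_stdGaussian_add {n : ℕ} {F : EuclideanSpace ℝ (Fin n) → ℝ}
    (hF : Continuous F) {a b : ℝ} (hb : 0 ≤ b) (hbound : ∀ v, |F v| ≤ a + b * ‖v‖) :
    HasGradientAt (fun h => ∫ v, F (v + h) ∂(stdGaussian n)) (∫ v, F v • v ∂(stdGaussian n)) 0 := by
  have hFae : AEStronglyMeasurable F (stdGaussian n) := hF.aestronglyMeasurable
  have hlin (v : EuclideanSpace ℝ (Fin n)) : |F v| ≤ (|a| + b) * Real.exp ‖v‖ := by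
    have h1 := Real.add_one_le_exp ‖v‖
    calc |F v| ≤ a + b * ‖v‖ := hbound v
      _ ≤ |a| * (‖v‖ + 1) + b * (‖v‖ + 1) := by
        nlinarith [le_abs_self a, mul_nonneg (abs_nonneg a) (norm_nonneg v)]
      _ = (|a| + b) * (‖v‖ + 1) := by ring
      _ ≤ (|a| + b) * Real.exp ‖v‖ := by gcongr
  have hFint : Integrable F (stdGaussian n) :=
    ((integrable_exp_mul_norm_stdGaussian n 1).const_mul (|a| + b)).mono' hFae
      (.of_forall fun v => by simpa using hlin v)
  have hFvint : Integrable (fun v => F v • v) (stdGaussian n) := by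
    refine ((integrable_exp_mul_norm_stdGaussian n 2).const_mul (|a| + b)).mono'
      (hF.smul continuous_id).aestronglyMeasurable (.of_forall fun v => ?_)
    rw [norm_smul, Real.norm_eq_abs, two_mul, Real.exp_add, ← mul_assoc]
    gcongr
    · exact hlin v
    · linarith [Real.add_one_le_exp ‖v‖]
  rw [hasGradientAt_iff_hasFDerivAt]
  simp_rw [integral_stdGaussian_add]
  have hderiv := hasFDerivAt_integral_of_dominated_of_fderiv_le (𝕜 := ℝ) (μ := stdGaussian n)
    (F := fun h v => Real.exp (inner ℝ h v - ‖h‖ ^ 2 / 2) • F v)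
    (F' := fun h v => (Real.exp (inner ℝ h v - ‖h‖ ^ 2 / 2) * F v) • innerSL ℝ (v - h))
    (bound := fun v => (|a| + b) * Real.exp (3 * ‖v‖))
    (s := Metric.ball (0 : EuclideanSpace ℝ (Fin n)) 1) (x₀ := 0)
    (Metric.ball_mem_nhds _ one_pos)
    (.of_forall fun h => Continuous.aestronglyMeasurable (by fun_prop))
    (by simpa using hFint)
    (Continuous.aestronglyMeasurable (by fun_prop))
    (.of_forall fun v h hh => by
      rw [mem_ball_zero_iff] at hh
      rw [norm_smul, norm_mul, innerSL_apply_norm, Real.norm_of_nonneg (Real.exp_pos _).le,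
        Real.norm_eq_abs, show 3 * ‖v‖ = ‖v‖ + ‖v‖ + ‖v‖ by ring, Real.exp_add, Real.exp_add]
      have h1 : inner ℝ h v - ‖h‖ ^ 2 / 2 ≤ ‖v‖ := by
        nlinarith [real_inner_le_norm h v, norm_nonneg v, sq_nonneg ‖h‖]
      have h2 : ‖v - h‖ ≤ Real.exp ‖v‖ := by
        linarith [norm_sub_le v h, Real.add_one_le_exp ‖v‖]
      calc Real.exp (inner ℝ h v - ‖h‖ ^ 2 / 2) * |F v| * ‖v - h‖
          ≤ Real.exp ‖v‖ * ((|a| + b) * Real.exp ‖v‖) * Real.exp ‖v‖ := by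
            gcongr
            exact hlin v
        _ = _ := by ring)
    ((integrable_exp_mul_norm_stdGaussian n 3).const_mul _)
    (.of_forall fun v h _ => by
      have h1 : HasFDerivAt (fun h => inner ℝ h v - ‖h‖ ^ 2 / 2) (innerSL ℝ (v - h)) h := by
        have h2 := ((innerSL ℝ v).hasFDerivAt (x := h)).sub
          (((hasStrictFDerivAt_norm_sq h).hasFDerivAt).const_mul (1 / 2 : ℝ))
        convert! h2 using 1
        · ext y
          simp [real_inner_comm]
          ring
        · ext y
          simp
      convert! h1.exp.smul_const (F v) using 1
      ext y
      simp
      ring)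
  convert! hderiv using 1
  ext w
  rw [ContinuousLinearMap.integral_apply]
  · rw [InnerProductSpace.toDual_apply_apply, real_inner_comm, ← integral_inner hFvint]
    refine integral_congr_ae (.of_forall fun v => ?_)
    simp [inner_smul_right, real_inner_comm]
  · exact hFvint.mono (Continuous.aestronglyMeasurable (by fun_prop))
      (.of_forall fun v => by simp [norm_smul])

end GaussianIntegrals

/-- the gradient of the Gaussian smoothing of a Lipschitz function is
`∇fᵘ(x) = E_{u ~ N(0,I)}[((f(x + μu) - f(x))/μ) u]`. -/
theorem gradient_gaussianSmoothing {n : ℕ} (f : EuclideanSpace ℝ (Fin n) → ℝ)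
    (L0 : ℝ) (hf : ∀ x y, |f x - f y| ≤ L0 * ‖x - y‖)
    (μ : ℝ) (hμ : 0 < μ) :
    ∀ x, gradient (gaussianSmoothing f μ) x =
      ∫ u, ((f (x + μ • u) - f x) / μ) • u ∂(stdGaussian n) := by
  intro x
  have hfLip : LipschitzWith (Real.toNNReal |L0|) f := by
    refine LipschitzWith.of_dist_le_mul fun y z => ?_
    rw [Real.dist_eq, dist_eq_norm, Real.coe_toNNReal _ (abs_nonneg _)]
    exact (hf y z).trans (by gcongr; exact le_abs_self L0)
  have hfc : Continuous f := hfLip.continuous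
  have hFc : Continuous fun v => f (x + μ • v) := by fun_prop
  have hbound (y v : EuclideanSpace ℝ (Fin n)) :
      |f (y + μ • v) - f y| ≤ 0 + |L0| * μ * ‖v‖ := by
    refine (hf _ _).trans ?_
    rw [add_sub_cancel_left, norm_smul, Real.norm_of_nonneg hμ.le, zero_add, mul_assoc]
    gcongr
    exact le_abs_self L0
  have hgrad := hasGradientAt_integral_stdGaussian_add (hFc.sub continuous_const)
    (mul_nonneg (abs_nonneg L0) hμ.le) (hbound x)
  have hid : Integrable (fun v => v) (stdGaussian n) := by
    rw [stdGaussian_eq]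
    exact ProbabilityTheory.IsGaussian.integrable_id
  have hprob : IsProbabilityMeasure (stdGaussian n) := by
    rw [stdGaussian_eq]
    infer_instance
  have hint (y : EuclideanSpace ℝ (Fin n)) :
      Integrable (fun v => f (y + μ • v)) (stdGaussian n) := by
    refine ((hid.norm.const_mul (|L0| * μ)).add (integrable_const |f y|)).mono'
      (Continuous.aestronglyMeasurable (by fun_prop)) (.of_forall fun v => ?_)
    rw [Real.norm_eq_abs]
    calc |f (y + μ • v)| ≤ |f (y + μ • v) - f y| + |f y| := by
          simpa using abs_add_le (f (y + μ • v) - f y) (f y)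
      _ ≤ |L0| * μ * ‖v‖ + |f y| := by
          gcongr
          simpa using hbound y v
  have hsmooth : gaussianSmoothing f μ = fun y =>
      (∫ v, (f (x + μ • (v + μ⁻¹ • (y - x))) - f x) ∂(stdGaussian n)) + f x := by
    ext y
    have h1 (v : EuclideanSpace ℝ (Fin n)) : x + μ • (v + μ⁻¹ • (y - x)) = y + μ • v := by
      rw [smul_add, smul_inv_smul₀ hμ.ne']
      abel
    simp_rw [h1]
    rw [integral_sub (hint y) (integrable_const _)]
    simp [gaussianSmoothing]
  have haff : HasFDerivAt (fun y : EuclideanSpace ℝ (Fin n) => μ⁻¹ • (y - x))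
      (μ⁻¹ • ContinuousLinearMap.id ℝ (EuclideanSpace ℝ (Fin n))) x :=
    ((hasFDerivAt_id x).sub_const x).const_smul μ⁻¹
  rw [hasGradientAt_iff_hasFDerivAt, ← show μ⁻¹ • (x - x) = 0 by simp] at hgrad
  apply HasGradientAt.gradient
  rw [hasGradientAt_iff_hasFDerivAt, hsmooth]
  convert! (hgrad.comp x haff).add_const (f x) using 1
  have h2 (v : EuclideanSpace ℝ (Fin n)) : ((f (x + μ • v) - f x) / μ) • v =
      μ⁻¹ • (f (x + μ • v) - f x) • v := by
    rw [smul_smul, div_eq_inv_mul]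
  simp_rw [h2, integral_smul]
  ext w
  simp
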